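/- arXiv:1403.7635 — 2 statements merged into one kernel-verified Lean document; each statement's English description precedes it below -/
import Mathlib

section
/- For all real numbers λ_1, λ_2 > 0, the integral of the function (y_1,y_2) ↦ λ_1 y_1² / (λ_1 y_1² + λ_2 y_2²) over the closed unit disk {y ∈ ℝ² : y_1² + y_2² ≤ 1} with respect to two-dimensional Lebesgue measure equals π √λ_1 / (√λ_1 + √λ_2). -/
open MeasureTheory Real

lemma den_pos_aux (a b x : ℝ) (ha : 0 < a) (hb : 0 < b) :
    0 < a * cos x ^ 2 + b * sin x ^ 2 := by
  have h := sin_sq_add_cos_sq x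
  rcases eq_or_ne (cos x) 0 with hc | hc
  · have : sin x ^ 2 = 1 := by rw [hc] at h; linarith
    rw [hc, this]; simpa using hb
  · have := sq_nonneg (sin x)
    positivity

lemma angular_aux (a b : ℝ) (ha : 0 < a) (hb : 0 < b) :
    ∫ x in (-π)..π, a ^ 2 * cos x ^ 2 / (a ^ 2 * cos x ^ 2 + b ^ 2 * sin x ^ 2)
      = 2 * π * a / (a + b) := by
  have hD : ∀ x, 0 < a ^ 2 * cos x ^ 2 + b ^ 2 * sin x ^ 2 :=
    fun x => den_pos_aux _ _ x (by positivity) (by positivity)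
  have hE : ∀ x, 0 < a * cos x ^ 2 + b * sin x ^ 2 := fun x => den_pos_aux _ _ x ha hb
  have hint : IntervalIntegrable
      (fun x => a ^ 2 * cos x ^ 2 / (a ^ 2 * cos x ^ 2 + b ^ 2 * sin x ^ 2)) volume (-π) π := by
    apply Continuous.intervalIntegrable
    exact Continuous.div (by fun_prop) (by fun_prop) (fun x => (hD x).ne')
  rcases eq_or_ne a b with hab | hab
  · subst hab
    have : ∀ x, a ^ 2 * cos x ^ 2 / (a ^ 2 * cos x ^ 2 + a ^ 2 * sin x ^ 2) = cos x ^ 2 := by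
      intro x
      rw [← mul_add, cos_sq_add_sin_sq]
      field_simp
    simp_rw [this]
    rw [integral_cos_sq]
    simp
    field_simp
    ring
  · have hsub : a - b ≠ 0 := sub_ne_zero.mpr hab
    have hder : ∀ x ∈ Set.uIcc (-π) π, HasDerivAt
        (fun x => a / (a + b) * x - a * b / ((a + b) * (a - b)) *
          arctan ((b - a) * (sin x * cos x) / (a * cos x ^ 2 + b * sin x ^ 2)))
        (a ^ 2 * cos x ^ 2 / (a ^ 2 * cos x ^ 2 + b ^ 2 * sin x ^ 2)) x := by
      intro x _
      have hs := hasDerivAt_sin x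
      have hc := hasDerivAt_cos x
      have hu := ((hs.mul hc).const_mul (b - a)).div
        (((hc.pow 2).const_mul a).add ((hs.pow 2).const_mul b)) (hE x).ne'
      have h := ((hasDerivAt_id x).const_mul (a / (a + b))).sub
        (hu.arctan.const_mul (a * b / ((a + b) * (a - b))))
      refine h.congr_deriv ?_
      have e := (hE x).ne'
      have d := (hD x).ne'
      have h1 := cos_sq_add_sin_sq x
      simp only [Pi.add_apply, Pi.mul_apply, Pi.pow_apply, Pi.div_apply]
      generalize cos x = c at *
      generalize sin x = s at *
      have hq : 1 + ((b - a) * (s * c) / (a * c ^ 2 + b * s ^ 2)) ^ 2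
          = (a ^ 2 * c ^ 2 + b ^ 2 * s ^ 2) / (a * c ^ 2 + b * s ^ 2) ^ 2 := by
        rw [eq_div_iff (by positivity)]
        field_simp
        linear_combination (a ^ 2 * c ^ 2 + b ^ 2 * s ^ 2) * h1
      rw [hq]
      have hab' : a + b ≠ 0 := by positivity
      have hs2 : s ^ 2 = 1 - c ^ 2 := by linarith
      have hnum : (b - a) * (c * c + s * -s) * (a * c ^ 2 + b * s ^ 2) -
          (b - a) * (s * c) * (a * (2 * c * -s) + b * (2 * s * c)) =
          a * b - (a ^ 2 * c ^ 2 + b ^ 2 * s ^ 2) := by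
        have e1 : (b - a) * (c * c + s * -s) * (a * c ^ 2 + b * s ^ 2) -
          (b - a) * (s * c) * (a * (2 * c * -s) + b * (2 * s * c)) =
          (b-a)*((c^2-s^2)*(a*c^2+b*s^2) - 2*(b-a)*(s^2*c^2)) := by ring
        rw [e1, hs2]; ring
      have hnum' := hnum
      norm_num at hnum ⊢
      rw [hnum]
      field_simp
      rw [hs2]
      ring
    rw [intervalIntegral.integral_eq_sub_of_hasDerivAt hder hint]
    simp
    field_simp
    ring

lemma radial_aux : ∫ r in Set.Ioi (0:ℝ), (if r ≤ 1 then r else 0) = 1 / 2 := by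
  have : (fun r : ℝ => if r ≤ 1 then r else 0) = (Set.Iic (1:ℝ)).indicator (fun r => r) := by
    ext r; simp [Set.indicator]
  rw [this, setIntegral_indicator measurableSet_Iic, Set.Ioi_inter_Iic,
    ← intervalIntegral.integral_of_le zero_le_one, integral_id]
  norm_num

/-- For λ₁, λ₂ > 0, the integral of
(y₁,y₂) ↦ λ₁ y₁² / (λ₁ y₁² + λ₂ y₂²) over the closed unit disk in ℝ²
(w.r.t. two-dimensional Lebesgue measure, integrand set to 0 at the origin)
equals π √λ₁ / (√λ₁ + √λ₂). -/
theorem sscm_disk_integral (l₁ l₂ : ℝ) (h₁ : 0 < l₁) (h₂ : 0 < l₂) :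
    (∫ y in {y : ℝ × ℝ | y.1 ^ 2 + y.2 ^ 2 ≤ 1},
        (if y = (0, 0) then 0 else l₁ * y.1 ^ 2 / (l₁ * y.1 ^ 2 + l₂ * y.2 ^ 2)))
      = π * Real.sqrt l₁ / (Real.sqrt l₁ + Real.sqrt l₂) := by
  obtain ⟨a, ha, rfl⟩ : ∃ a : ℝ, 0 < a ∧ a ^ 2 = l₁ := ⟨√l₁, by positivity, sq_sqrt h₁.le⟩
  obtain ⟨b, hb, rfl⟩ : ∃ b : ℝ, 0 < b ∧ b ^ 2 = l₂ := ⟨√l₂, by positivity, sq_sqrt h₂.le⟩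
  rw [sqrt_sq ha.le, sqrt_sq hb.le]
  have hm : MeasurableSet {y : ℝ × ℝ | y.1 ^ 2 + y.2 ^ 2 ≤ 1} :=
    measurableSet_le (by fun_prop) (by fun_prop)
  rw [← integral_indicator hm, ← integral_comp_polarCoord_symm]
  have hpt : polarCoord.target = Set.Ioi (0 : ℝ) ×ˢ Set.Ioo (-π) π := rfl
  have hcongr : ∀ p ∈ polarCoord.target,
      p.1 • Set.indicator {y : ℝ × ℝ | y.1 ^ 2 + y.2 ^ 2 ≤ 1}
        (fun y => if y = (0, 0) then 0 else a ^ 2 * y.1 ^ 2 / (a ^ 2 * y.1 ^ 2 + b ^ 2 * y.2 ^ 2))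
        (polarCoord.symm p) =
      (fun r : ℝ => if r ≤ 1 then r else 0) p.1 *
      (fun x : ℝ => a ^ 2 * cos x ^ 2 / (a ^ 2 * cos x ^ 2 + b ^ 2 * sin x ^ 2)) p.2 := by
    rintro ⟨r, x⟩ hp
    have hr : 0 < r := hp.1
    have h1 := cos_sq_add_sin_sq x
    have hn : (r * cos x) ^ 2 + (r * sin x) ^ 2 = r ^ 2 := by
      linear_combination r ^ 2 * h1
    have hne : (r * cos x, r * sin x) ≠ ((0 : ℝ), (0 : ℝ)) := by
      intro h
      rw [Prod.mk.injEq] at h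
      rw [h.1, h.2] at hn
      have : 0 < r ^ 2 := by positivity
      norm_num at hn
      linarith
    have hD := den_pos_aux (a ^ 2) (b ^ 2) x (by positivity) (by positivity)
    have hle : r ^ 2 ≤ 1 ↔ r ≤ 1 := by
      constructor <;> intro h <;> nlinarith
    simp only [polarCoord_symm_apply, Set.indicator, Set.mem_ofPred_eq, hn, hle, if_neg hne,
      smul_eq_mul]
    split_ifs
    · congr 1
      rw [show a ^ 2 * (r * cos x) ^ 2 + b ^ 2 * (r * sin x) ^ 2 =
        r ^ 2 * (a ^ 2 * cos x ^ 2 + b ^ 2 * sin x ^ 2) by ring,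
        show a ^ 2 * (r * cos x) ^ 2 = r ^ 2 * (a ^ 2 * cos x ^ 2) by ring]
      exact mul_div_mul_left _ _ (by positivity)
    · simp
  rw [setIntegral_congr_fun polarCoord.open_target.measurableSet hcongr, hpt,
    Measure.volume_eq_prod,
    setIntegral_prod_mul (fun r : ℝ => if r ≤ 1 then r else 0)
      (fun x : ℝ => a ^ 2 * cos x ^ 2 / (a ^ 2 * cos x ^ 2 + b ^ 2 * sin x ^ 2)),
    radial_aux, ← integral_Ioc_eq_integral_Ioo,
    ← intervalIntegral.integral_of_le (by linarith [pi_pos]), angular_aux a b ha hb]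
  ring
end

section
/- Let X have a bivariate elliptical distribution F ∈ E_2(μ,V) with V = U Λ U^T, U orthogonal, Λ = diag(λ_1,λ_2), λ_1 > λ_2 > 0. Then the covariance matrix of the random vector vec(s(X−μ) s(X−μ)^T) ∈ ℝ⁴ equals w · (U ⊗ U) W_0 (U ⊗ U)^T, where w = (−λ_1 λ_2 + (1/2)√(λ_1 λ_2)(λ_1 + λ_2)) / (λ_1 − λ_2)² and W_0 is the 4×4 matrix with rows (1,0,0,−1), (0,1,1,0), (0,1,1,0), (−1,0,0,1). -/
open MeasureTheory Matrix Real

/-- The spatial sign s(x) = x/‖x‖ for x ≠ 0, and s(0) = 0. -/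
noncomputable def ssign {p : ℕ} (x : EuclideanSpace ℝ (Fin p)) : EuclideanSpace ℝ (Fin p) :=
  haveI := Classical.propDecidable (x = 0)
  if x = 0 then 0 else ‖x‖⁻¹ • x

/-- `vec` of a 2×2 matrix: stacks the columns on top of each other (left to right). -/
def vec4 (M : Matrix (Fin 2) (Fin 2) ℝ) : Fin 4 → ℝ := ![M 0 0, M 1 0, M 0 1, M 1 1]

/-- The Kronecker product U ⊗ U of a 2×2 matrix with itself, written as a 4×4 matrix,
with the index flattening convention matching `vec4`. -/
def kron4 (U : Matrix (Fin 2) (Fin 2) ℝ) : Matrix (Fin 4) (Fin 4) ℝ :=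
  Matrix.of fun k l =>
    U (![0, 0, 1, 1] k) (![0, 0, 1, 1] l) * U (![0, 1, 0, 1] k) (![0, 1, 0, 1] l)

/-- The matrix W₀ with rows (1,0,0,−1), (0,1,1,0), (0,1,1,0), (−1,0,0,1). -/
def W0mat : Matrix (Fin 4) (Fin 4) ℝ :=
  !![1, 0, 0, -1; 0, 1, 1, 0; 0, 1, 1, 0; -1, 0, 0, 1]

/-- The squared direction of `c w + d w̄`. -/
noncomputable def zdir (c d : ℝ) (w : ℂ) : ℂ :=
  (c * w + d * (starRingEnd ℂ) w) / (c * (starRingEnd ℂ) w + d * w)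

lemma zdir_measurable (c d : ℝ) : Measurable (zdir c d) := by
  have h : Measurable (starRingEnd ℂ) := Complex.continuous_conj.measurable
  unfold zdir
  fun_prop

lemma zdir_norm_le (c d : ℝ) (w : ℂ) : ‖zdir c d w‖ ≤ 1 := by
  have h : (c * (starRingEnd ℂ) w + d * w) = (starRingEnd ℂ) (c * w + d * (starRingEnd ℂ) w) := by
    simp
  rw [zdir, h, norm_div, RCLike.norm_conj]
  exact div_self_le_one _

lemma zdir_mean (c d : ℝ) (hd : 0 ≤ d) (hdc : d < c) (n : ℕ) (w : ℂ) (hw : w ≠ 0) :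
    ∫ θ in (0 : ℝ)..2 * π, zdir c d (Circle.exp θ * w) ^ n = (2 * π) * ((d : ℂ) / c) ^ n := by
  have hc : 0 < c := lt_of_le_of_lt hd hdc
  have hwb : (starRingEnd ℂ) w ≠ 0 := by simpa using hw
  set f : ℂ → ℂ := fun ζ => ((c * ζ ^ 2 * w + d * (starRingEnd ℂ) w) /
    (c * (starRingEnd ℂ) w + d * ζ ^ 2 * w)) ^ n with hf
  have hden : ∀ ζ : ℂ, ‖ζ‖ ≤ 1 → c * (starRingEnd ℂ) w + d * ζ ^ 2 * w ≠ 0 := by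
    intro ζ hζ h0
    have h1 : (c : ℂ) * (starRingEnd ℂ) w = - (d * ζ ^ 2 * w) := by linear_combination h0
    have h2 := congrArg norm h1
    simp only [norm_mul, norm_neg, norm_pow, RCLike.norm_conj, Complex.norm_real,
      Real.norm_eq_abs, abs_of_pos hc, abs_of_nonneg hd] at h2
    have h3 : ‖ζ‖ ^ 2 ≤ 1 := pow_le_one₀ (norm_nonneg _) hζ
    have h4 : 0 < ‖w‖ := norm_pos_iff.2 hw
    have h5 : d * ‖ζ‖ ^ 2 ≤ d := by nlinarith
    nlinarith
  have hdiff : ∀ ζ : ℂ, ‖ζ‖ ≤ 1 → DifferentiableAt ℂ f ζ := by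
    intro ζ hζ
    have := hden ζ hζ
    rw [hf]
    fun_prop (disch := assumption)
  have hav : circleAverage f 0 1 = f 0 := by
    apply circleAverage_of_differentiable_on_off_countable Set.countable_empty
    · intro ζ hζ
      exact (hdiff ζ (by simpa using hζ)).continuousAt.continuousWithinAt
    · intro ζ hζ
      refine hdiff ζ ?_
      have : ‖ζ‖ < 1 := by simpa using hζ.1
      exact this.le
  rw [Real.circleAverage_def] at hav
  have hcongr : ∀ θ : ℝ, zdir c d (Circle.exp θ * w) ^ n = f (circleMap 0 1 θ) := by
    intro θ
    have e1 : circleMap 0 1 θ = (Circle.exp θ : ℂ) := by simp [circleMap]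
    rw [e1]
    set ζ : Circle := Circle.exp θ
    have hz : (starRingEnd ℂ) (ζ : ℂ) * ζ = 1 := by
      rw [mul_comm, Complex.mul_conj]; simp [Complex.normSq_eq_norm_sq, Circle.norm_coe]
    have hz0 : (ζ : ℂ) ≠ 0 := Circle.coe_ne_zero ζ
    simp only [hf, zdir, map_mul]
    congr 1
    rw [← mul_div_mul_left _ _ hz0]
    congr 1
    · linear_combination (d * (starRingEnd ℂ) w) * hz
    · linear_combination (c * (starRingEnd ℂ) w) * hz
  simp_rw [hcongr]
  have hf0 : f 0 = ((d : ℂ) / c) ^ n := by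
    simp only [hf]
    congr 1
    simp
    rw [mul_div_mul_right _ _ hwb]
  rw [← hf0, ← hav]
  have : (π : ℂ) ≠ 0 := by exact_mod_cast pi_ne_zero
  rw [Complex.real_smul]
  push_cast
  field_simp

lemma zdir_integral (P : Measure ℂ) [IsProbabilityMeasure P]
    (hrot : ∀ ζ : Circle, P.map (fun w => (ζ : ℂ) * w) = P) (h0 : ∀ᵐ w ∂P, w ≠ 0)
    (c d : ℝ) (hd : 0 ≤ d) (hdc : d < c) (n : ℕ) :
    ∫ w, zdir c d w ^ n ∂P = ((d : ℂ) / c) ^ n := by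
  have hm : Measurable fun w => zdir c d w ^ n := (zdir_measurable c d).pow_const n
  have h1 : ∀ θ : ℝ, ∫ w, zdir c d (Circle.exp θ * w) ^ n ∂P = ∫ w, zdir c d w ^ n ∂P := by
    intro θ
    conv_rhs => rw [← hrot (Circle.exp θ)]
    rw [integral_map (by fun_prop) hm.aestronglyMeasurable]
  have h2 : ∫ θ in (0 : ℝ)..2 * π, ∫ w, zdir c d (Circle.exp θ * w) ^ n ∂P
      = (2 * π) * ∫ w, zdir c d w ^ n ∂P := by
    simp_rw [h1]
    simp
  rw [intervalIntegral_integral_swap] at h2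
  · have h3 : ∫ w, (∫ θ in (0 : ℝ)..2 * π, zdir c d (Circle.exp θ * w) ^ n) ∂P
        = ∫ w, (2 * π) * ((d : ℂ) / c) ^ n ∂P := by
      apply integral_congr_ae
      filter_upwards [h0] with w hw using zdir_mean c d hd hdc n w hw
    rw [h3] at h2
    simp only [integral_const, probReal_univ, one_smul] at h2
    have : (2 * π : ℂ) ≠ 0 := by exact_mod_cast two_pi_pos.ne'
    exact (mul_left_cancel₀ this h2).symm
  · have : IsFiniteMeasure ((volume : Measure ℝ).restrict (Set.uIoc 0 (2 * π))) :=
      ⟨by simp [Set.uIoc]⟩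
    apply Integrable.of_bound (C := 1)
    · apply Measurable.aestronglyMeasurable
      apply hm.comp
      have : Continuous fun p : ℝ × ℂ => (Circle.exp p.1 : ℂ) * p.2 := by fun_prop
      exact this.measurable
    · refine Filter.Eventually.of_forall fun p => ?_
      simp only [Function.uncurry, norm_pow]
      exact pow_le_one₀ (norm_nonneg _) (zdir_norm_le _ _ _)

lemma map_withDensity_equiv {α β : Type*} [MeasurableSpace α] [MeasurableSpace β]
    (e : α ≃ᵐ β) (ν : Measure α) (k : β → ENNReal) :
    (ν.withDensity (fun x => k (e x))).map e = (ν.map e).withDensity k := by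
  ext s hs
  rw [e.map_apply, withDensity_apply _ (e.measurable hs), withDensity_apply _ hs,
    e.restrict_map, lintegral_map_equiv]

lemma haar_rot (ν : Measure ℂ) [ν.IsAddHaarMeasure] (ζ : Circle) :
    ν.map (rotation ζ) = ν := by
  rw [Measure.isAddLeftInvariant_eq_smul ν volume, Measure.map_smul,
    (rotation ζ).measurePreserving.map_eq]

lemma radial_rot (ν : Measure ℂ) [ν.IsAddHaarMeasure] (k : ℝ → ENNReal) (ζ : Circle) :
    (ν.withDensity (fun w => k (Complex.normSq w))).map (fun w => (ζ : ℂ) * w)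
      = ν.withDensity (fun w => k (Complex.normSq w)) := by
  have h := map_withDensity_equiv (rotation ζ).toHomeomorph.toMeasurableEquiv ν
    (fun w => k (Complex.normSq w))
  have e1 : ((rotation ζ).toHomeomorph.toMeasurableEquiv : ℂ → ℂ) = fun w => (ζ : ℂ) * w := by
    ext w; simp
  have e2 : ((rotation ζ).toHomeomorph.toMeasurableEquiv : ℂ → ℂ) = rotation ζ := rfl
  have e3 : ν.map (fun w => (ζ : ℂ) * w) = ν := by
    rw [← e1, e2]; exact haar_rot ν ζ
  rw [e1, e3] at h
  simpa [Complex.normSq_mul, Complex.normSq_eq_norm_sq, Circle.norm_coe] using h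

/-- Linear change of coordinates to the spherical case. -/
noncomputable def ell (U : Matrix (Fin 2) (Fin 2) ℝ) (hU : U * Uᵀ = 1) (a b : ℝ)
    (ha : 0 < a) (hb : 0 < b) : EuclideanSpace ℝ (Fin 2) ≃ₗ[ℝ] ℂ where
  toFun x := ⟨(U 0 0 * x 0 + U 1 0 * x 1) / a, (U 0 1 * x 0 + U 1 1 * x 1) / b⟩
  invFun w := !₂[U 0 0 * (a * w.re) + U 0 1 * (b * w.im), U 1 0 * (a * w.re) + U 1 1 * (b * w.im)]
  map_add' x y := by
    apply Complex.ext <;> simp <;> ring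
  map_smul' r x := by
    apply Complex.ext <;> simp <;> ring
  left_inv x := by
    have h00 := congrFun (congrFun hU 0) 0
    have h01 := congrFun (congrFun hU 0) 1
    have h11 := congrFun (congrFun hU 1) 1
    simp [Matrix.mul_apply, Fin.sum_univ_two] at h00 h01 h11
    ext i
    fin_cases i
    · simp
      field_simp
      linear_combination x 0 * h00 + x 1 * h01
    · simp
      field_simp
      linear_combination x 1 * h11 + x 0 * h01
  right_inv w := by
    have hU' : Uᵀ * U = 1 := mul_eq_one_comm.1 hU
    have h00 := congrFun (congrFun hU' 0) 0
    have h01 := congrFun (congrFun hU' 0) 1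
    have h11 := congrFun (congrFun hU' 1) 1
    simp [Matrix.mul_apply, Fin.sum_univ_two] at h00 h01 h11
    apply Complex.ext
    · simp
      field_simp
      linear_combination w.re * a * h00 + b * w.im * h01
    · simp
      field_simp
      linear_combination w.im * b * h11 + a * w.re * h01

lemma zdir_pq (a b : ℝ) (w : ℂ) :
    zdir ((a + b) / 2) ((a - b) / 2) w =
      ⟨((a * w.re) ^ 2 - (b * w.im) ^ 2) / ((a * w.re) ^ 2 + (b * w.im) ^ 2),
        2 * (a * w.re) * (b * w.im) / ((a * w.re) ^ 2 + (b * w.im) ^ 2)⟩ := by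
  have h1 : ((((a + b) / 2 : ℝ) : ℂ) * w + (((a - b) / 2 : ℝ) : ℂ) * (starRingEnd ℂ) w)
      = ⟨a * w.re, b * w.im⟩ := by
    apply Complex.ext <;> simp <;> ring
  have h2 : ((((a + b) / 2 : ℝ) : ℂ) * (starRingEnd ℂ) w + (((a - b) / 2 : ℝ) : ℂ) * w)
      = ⟨a * w.re, -(b * w.im)⟩ := by
    apply Complex.ext <;> simp <;> ring
  rw [zdir, h1, h2]
  apply Complex.ext
  · simp only [Complex.div_re, Complex.normSq_apply]
    ring
  · simp only [Complex.div_im, Complex.normSq_apply]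
    ring

lemma ssign_mul (U : Matrix (Fin 2) (Fin 2) ℝ) (hU : U * Uᵀ = 1) (a b : ℝ)
    (ha : 0 < a) (hb : 0 < b) (y : EuclideanSpace ℝ (Fin 2)) (hy : y ≠ 0) (i j : Fin 2) :
    ssign y i * ssign y j =
      (U i 0 * U j 0 + U i 1 * U j 1) / 2
      + (U i 0 * U j 0 - U i 1 * U j 1) / 2 *
          (zdir ((a + b) / 2) ((a - b) / 2) (ell U hU a b ha hb y)).re
      + (U i 0 * U j 1 + U i 1 * U j 0) / 2 *
          (zdir ((a + b) / 2) ((a - b) / 2) (ell U hU a b ha hb y)).im := by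
  obtain ⟨w, rfl⟩ := (ell U hU a b ha hb).symm.surjective y
  have hU' : Uᵀ * U = 1 := mul_eq_one_comm.1 hU
  have h00 := congrFun (congrFun hU' 0) 0
  have h01 := congrFun (congrFun hU' 0) 1
  have h11 := congrFun (congrFun hU' 1) 1
  simp [Matrix.mul_apply, Fin.sum_univ_two] at h00 h01 h11
  rw [LinearEquiv.apply_symm_apply, zdir_pq]
  set y := (ell U hU a b ha hb).symm w with hyw
  have hyi : ∀ i, y i = U i 0 * (a * w.re) + U i 1 * (b * w.im) := by
    intro i
    fin_cases i <;> rfl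
  generalize a * w.re = p at *
  generalize b * w.im = q at *
  have hn : ‖y‖ ^ 2 = p ^ 2 + q ^ 2 := by
    rw [EuclideanSpace.norm_sq_eq, Fin.sum_univ_two, hyi, hyi]
    simp only [Real.norm_eq_abs, sq_abs]
    linear_combination p ^ 2 * h00 + q ^ 2 * h11 + 2 * p * q * h01
  have hpos : 0 < ‖y‖ := norm_pos_iff.2 hy
  have hpq : p ^ 2 + q ^ 2 ≠ 0 := by rw [← hn]; positivity
  have hs : ∀ i, ssign y i = y i / ‖y‖ := by
    intro i
    simp [ssign, hy]
    ring
  rw [hs, hs, div_mul_div_comm, ← sq, hn, hyi, hyi]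
  field_simp
  ring

lemma quad_eq (U V : Matrix (Fin 2) (Fin 2) ℝ) (hU : U * Uᵀ = 1) (a b : ℝ)
    (ha : 0 < a) (hb : 0 < b) (hV : V = U * Matrix.diagonal ![a ^ 2, b ^ 2] * Uᵀ)
    (y : EuclideanSpace ℝ (Fin 2)) :
    ∑ i, ∑ j, y i * V⁻¹ i j * y j = Complex.normSq (ell U hU a b ha hb y) := by
  have hU' : Uᵀ * U = 1 := mul_eq_one_comm.1 hU
  have hinv : V⁻¹ = U * Matrix.diagonal ![(a ^ 2)⁻¹, (b ^ 2)⁻¹] * Uᵀ := by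
    apply Matrix.inv_eq_right_inv
    have hD : Matrix.diagonal ![a ^ 2, b ^ 2] * Matrix.diagonal ![(a ^ 2)⁻¹, (b ^ 2)⁻¹]
        = (1 : Matrix (Fin 2) (Fin 2) ℝ) := by
      rw [Matrix.diagonal_mul_diagonal, ← Matrix.diagonal_one]
      congr 1
      ext i
      fin_cases i <;> simp <;> field_simp
    calc V * (U * Matrix.diagonal ![(a ^ 2)⁻¹, (b ^ 2)⁻¹] * Uᵀ)
        = U * (Matrix.diagonal ![a ^ 2, b ^ 2] * (Uᵀ * U) *
            Matrix.diagonal ![(a ^ 2)⁻¹, (b ^ 2)⁻¹]) * Uᵀ := by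
          rw [hV]; simp only [Matrix.mul_assoc]
      _ = 1 := by rw [hU', Matrix.mul_one, hD, Matrix.mul_one, hU]
  have hell : ell U hU a b ha hb y =
    ⟨(U 0 0 * y 0 + U 1 0 * y 1) / a, (U 0 1 * y 0 + U 1 1 * y 1) / b⟩ := rfl
  rw [hinv, hell, Complex.normSq_apply]
  simp [Fin.sum_univ_two, Matrix.mul_apply, Matrix.diagonal]
  field_simp
  ring

lemma cov_aux {Ω : Type*} [MeasurableSpace Ω] (P : Measure Ω) [IsProbabilityMeasure P]
    (Z : Ω → ℂ) (hZ : Measurable Z) (hb : ∀ᵐ w ∂P, ‖Z w‖ = 1) (r : ℝ)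
    (h1 : ∫ w, Z w ∂P = r) (h2 : ∫ w, Z w ^ 2 ∂P = (r : ℂ) ^ 2) (A B C A2 B2 C2 : ℝ) :
    (∫ w, (A + B * (Z w).re + C * (Z w).im) * (A2 + B2 * (Z w).re + C2 * (Z w).im) ∂P)
     - (∫ w, (A + B * (Z w).re + C * (Z w).im) ∂P) *
       (∫ w, (A2 + B2 * (Z w).re + C2 * (Z w).im) ∂P)
     = (1 - r ^ 2) / 2 * (B * B2 + C * C2) := by
  have i1 : Integrable Z P := Integrable.of_bound hZ.aestronglyMeasurable 1
    (by filter_upwards [hb] with w hw using hw.le)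
  have i2 : Integrable (fun w => Z w ^ 2) P :=
    Integrable.of_bound (hZ.pow_const 2).aestronglyMeasurable 1
    (by filter_upwards [hb] with w hw; simp [hw])
  have ir : Integrable (fun w => (Z w).re) P := i1.re
  have ii : Integrable (fun w => (Z w).im) P := i1.im
  have ir2 : Integrable (fun w => (Z w ^ 2).re) P := i2.re
  have ii2 : Integrable (fun w => (Z w ^ 2).im) P := i2.im
  have er : ∫ w, (Z w).re ∂P = r := by
    have := integral_re i1
    simp only [RCLike.re_to_complex] at this
    rw [this, h1]; simp
  have ei : ∫ w, (Z w).im ∂P = 0 := by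
    have := integral_im i1
    simp only [RCLike.im_to_complex] at this
    rw [this, h1]; simp
  have er2 : ∫ w, (Z w ^ 2).re ∂P = r ^ 2 := by
    have := integral_re i2
    simp only [RCLike.re_to_complex] at this
    rw [this, h2]; norm_cast
  have ei2 : ∫ w, (Z w ^ 2).im ∂P = 0 := by
    have := integral_im i2
    simp only [RCLike.im_to_complex] at this
    rw [this, h2]; norm_cast
  have lin : ∀ α β γ δ ε : ℝ, ∫ w, (α + β * (Z w).re + γ * (Z w).im + δ * (Z w ^ 2).re
      + ε * (Z w ^ 2).im) ∂P = α + β * r + δ * r ^ 2 := by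
    intro α β γ δ ε
    rw [integral_add (by fun_prop) (by fun_prop), integral_add (by fun_prop) (by fun_prop),
      integral_add (by fun_prop) (by fun_prop), integral_add (by fun_prop) (by fun_prop)]
    simp only [integral_const_mul, er, ei, er2, ei2]
    simp
  have l1 : ∀ A B C : ℝ, ∫ w, (A + B * (Z w).re + C * (Z w).im) ∂P = A + B * r := by
    intro A B C
    simpa using lin A B C 0 0
  have l2 : ∫ w, (A + B * (Z w).re + C * (Z w).im) * (A2 + B2 * (Z w).re + C2 * (Z w).im) ∂P
      = (A * A2 + (B * B2 + C * C2) / 2) + (A * B2 + A2 * B) * r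
        + (B * B2 - C * C2) / 2 * r ^ 2 := by
    rw [← lin _ _ (A * C2 + A2 * C) _ ((B * C2 + C * B2) / 2)]
    apply integral_congr_ae
    filter_upwards [hb] with w hw
    have hn : (Z w).re ^ 2 + (Z w).im ^ 2 = 1 := by
      have := Complex.sq_norm (Z w)
      rw [hw, Complex.normSq_apply] at this
      linarith
    simp only [sq, Complex.mul_re, Complex.mul_im] at hn ⊢
    linear_combination ((B * B2 + C * C2) / 2) * hn
  rw [l1, l1, l2]
  ring

lemma kron_entry (U : Matrix (Fin 2) (Fin 2) ℝ) (k l : Fin 4) (i j i2 j2 : Fin 2)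
    (hi : i = ![0, 1, 0, 1] k) (hj : j = ![0, 0, 1, 1] k)
    (hi' : i2 = ![0, 1, 0, 1] l) (hj' : j2 = ![0, 0, 1, 1] l) :
    (kron4 U * W0mat * (kron4 U)ᵀ) k l =
      (U i 0 * U j 0 - U i 1 * U j 1) * (U i2 0 * U j2 0 - U i2 1 * U j2 1)
      + (U i 0 * U j 1 + U i 1 * U j 0) * (U i2 0 * U j2 1 + U i2 1 * U j2 0) := by
  simp only [Matrix.mul_apply, Fin.sum_univ_four, kron4, W0mat, Matrix.transpose_apply,
    Matrix.of_apply, ← hi, ← hj, ← hi', ← hj']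
  simp
  ring

lemma vec4_apply (M : Matrix (Fin 2) (Fin 2) ℝ) (k : Fin 4) :
    vec4 M k = M (![0, 1, 0, 1] k) (![0, 0, 1, 1] k) := by
  fin_cases k <;> rfl

lemma zdir_norm_eq (a b : ℝ) (ha : 0 < a) (hb : 0 < b) (w : ℂ) (hw : w ≠ 0) :
    ‖zdir ((a + b) / 2) ((a - b) / 2) w‖ = 1 := by
  have hz' := zdir_pq a b w
  have hpq : (a * w.re) ^ 2 + (b * w.im) ^ 2 ≠ 0 := by
    intro h
    apply hw
    have h1 : (a * w.re) ^ 2 = 0 := by nlinarith [sq_nonneg (a * w.re), sq_nonneg (b * w.im)]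
    have h2 : (b * w.im) ^ 2 = 0 := by nlinarith [sq_nonneg (a * w.re), sq_nonneg (b * w.im)]
    apply Complex.ext
    · simpa [ha.ne'] using h1
    · simpa [hb.ne'] using h2
  generalize a * w.re = p at *
  generalize b * w.im = q at *
  rw [← sq_eq_sq₀ (norm_nonneg _) zero_le_one, Complex.sq_norm, hz', Complex.normSq_apply]
  field_simp
  ring

/-- For a bivariate elliptical distribution F ∈ E₂(μ,V) with
V = U Λ Uᵀ, λ₁ > λ₂ > 0, the covariance matrix of vec(s(X−μ) s(X−μ)ᵀ) ∈ ℝ⁴ equals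
w (U ⊗ U) W₀ (U ⊗ U)ᵀ with w = (−λ₁λ₂ + ½√(λ₁λ₂)(λ₁+λ₂))/(λ₁−λ₂)². -/
theorem sscm_covariance_of_sign_outer_product
    (μ : EuclideanSpace ℝ (Fin 2)) (V : Matrix (Fin 2) (Fin 2) ℝ) (hV : V.PosDef)
    (g : ℝ → ℝ) (hg : ∀ t, 0 ≤ t → 0 ≤ g t)
    (F : Measure (EuclideanSpace ℝ (Fin 2))) [IsProbabilityMeasure F]
    (hF : F = volume.withDensity fun x => ENNReal.ofReal
        ((Real.sqrt V.det)⁻¹ * g (∑ i, ∑ j, (x i - μ i) * V⁻¹ i j * (x j - μ j))))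
    (U : Matrix (Fin 2) (Fin 2) ℝ) (hU : U * Uᵀ = 1)
    (l₁ l₂ : ℝ) (hl₂ : 0 < l₂) (hl₁₂ : l₂ < l₁)
    (hVdec : V = U * Matrix.diagonal ![l₁, l₂] * Uᵀ) :
    (Matrix.of fun k l : Fin 4 =>
        (∫ x, vec4 (Matrix.of fun i j => ssign (x - μ) i * ssign (x - μ) j) k *
              vec4 (Matrix.of fun i j => ssign (x - μ) i * ssign (x - μ) j) l ∂F)
        - (∫ x, vec4 (Matrix.of fun i j => ssign (x - μ) i * ssign (x - μ) j) k ∂F) *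
          (∫ x, vec4 (Matrix.of fun i j => ssign (x - μ) i * ssign (x - μ) j) l ∂F))
      = ((-(l₁ * l₂) + (1 / 2) * Real.sqrt (l₁ * l₂) * (l₁ + l₂)) / (l₁ - l₂) ^ 2) •
          (kron4 U * W0mat * (kron4 U)ᵀ) := by
  obtain ⟨a, ha, rfl⟩ : ∃ a : ℝ, 0 < a ∧ a ^ 2 = l₁ :=
    ⟨√l₁, Real.sqrt_pos.2 (hl₂.trans hl₁₂), Real.sq_sqrt (hl₂.trans hl₁₂).le⟩
  obtain ⟨b, hb, rfl⟩ : ∃ b : ℝ, 0 < b ∧ b ^ 2 = l₂ :=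
    ⟨√l₂, Real.sqrt_pos.2 hl₂, Real.sq_sqrt hl₂.le⟩
  have hba : b < a := lt_of_pow_lt_pow_left₀ 2 ha.le hl₁₂
  set L := ell U hU a b ha hb with hL
  let e : EuclideanSpace ℝ (Fin 2) ≃ᵐ ℂ :=
    ((Homeomorph.addRight (-μ)).trans L.toContinuousLinearEquiv.toHomeomorph).toMeasurableEquiv
  have he : ∀ x, e x = L (x - μ) := by
    intro x
    rw [sub_eq_add_neg]; rfl
  let ν : Measure ℂ := volume.map L
  have hν : volume.map e = ν := by
    have : (e : EuclideanSpace ℝ (Fin 2) → ℂ) = L ∘ (fun x => x + (-μ)) := by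
      ext x; simp [he, sub_eq_add_neg]
    have hLm : Measurable L := L.toContinuousLinearEquiv.continuous.measurable
    rw [this, ← Measure.map_map hLm (by fun_prop), map_add_right_eq_self]
  let k : ℝ → ENNReal := fun t => ENNReal.ofReal ((Real.sqrt V.det)⁻¹ * g t)
  let P : Measure ℂ := F.map e
  have hP : P = ν.withDensity fun w => k (Complex.normSq w) := by
    have h := map_withDensity_equiv e volume (fun w => k (Complex.normSq w))
    rw [hν] at h
    rw [← h]
    simp only [P]
    congr 1
    rw [hF]
    congr 1
    ext x
    simp only [k]
    rw [he, ← quad_eq U V hU a b ha hb hVdec (x - μ)]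
    rfl
  have hν' : ν.IsAddHaarMeasure := by
    simp only [ν]
    infer_instance
  have hPp : IsProbabilityMeasure P := Measure.isProbabilityMeasure_map e.measurable.aemeasurable
  have hrot : ∀ ζ : Circle, P.map (fun w => (ζ : ℂ) * w) = P := by
    intro ζ
    rw [hP]
    exact radial_rot ν k ζ
  have h0 : ∀ᵐ w ∂P, w ≠ 0 := by
    have hac : P ≪ ν := by rw [hP]; exact withDensity_absolutelyContinuous _ _
    exact hac.ae_le (Measure.ae_ne ν 0)
  have h0F : ∀ᵐ x ∂F, x - μ ≠ 0 := by
    have := (ae_map_iff e.measurable.aemeasurable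
      (measurableSet_singleton (0 : ℂ)).compl).1 h0
    filter_upwards [this] with x hx hx0
    apply hx
    simp [he, hx0]
  set c : ℝ := (a + b) / 2 with hc
  set d : ℝ := (a - b) / 2 with hd
  let Z : EuclideanSpace ℝ (Fin 2) → ℂ := fun x => zdir c d (e x)
  have hZm : Measurable Z := (zdir_measurable c d).comp e.measurable
  have hZ1 : ∀ᵐ x ∂F, ‖Z x‖ = 1 := by
    filter_upwards [h0F] with x hx
    apply zdir_norm_eq a b ha hb
    rw [he]
    exact (map_ne_zero_iff L L.injective).2 hx
  have hint : ∀ n : ℕ, ∫ x, Z x ^ n ∂F = ((d : ℂ) / c) ^ n := by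
    intro n
    rw [← zdir_integral P hrot h0 c d (by linarith) (by linarith) n]
    simp only [P]
    rw [integral_map_equiv]
  have key := cov_aux F Z hZm hZ1 (d / c) (by simpa using hint 1) (by simpa using hint 2)
  have hvec : ∀ k : Fin 4, ∀ᵐ x ∂F,
      vec4 (Matrix.of fun i j => ssign (x - μ) i * ssign (x - μ) j) k =
      (U (![0, 1, 0, 1] k) 0 * U (![0, 0, 1, 1] k) 0
        + U (![0, 1, 0, 1] k) 1 * U (![0, 0, 1, 1] k) 1) / 2
      + (U (![0, 1, 0, 1] k) 0 * U (![0, 0, 1, 1] k) 0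
        - U (![0, 1, 0, 1] k) 1 * U (![0, 0, 1, 1] k) 1) / 2 * (Z x).re
      + (U (![0, 1, 0, 1] k) 0 * U (![0, 0, 1, 1] k) 1
        + U (![0, 1, 0, 1] k) 1 * U (![0, 0, 1, 1] k) 0) / 2 * (Z x).im := by
    intro k
    filter_upwards [h0F] with x hx
    rw [vec4_apply, Matrix.of_apply, ssign_mul U hU a b ha hb _ hx]
    simp only [Z, he, hL, hc, hd]
  ext k l
  rw [Matrix.of_apply, Matrix.smul_apply, kron_entry U k l _ _ _ _ rfl rfl rfl rfl,
    integral_congr_ae (hvec k), integral_congr_ae (hvec l)]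
  have hkl := integral_congr_ae (Filter.EventuallyEq.mul (hvec k) (hvec l))
  simp only [Pi.mul_apply] at hkl
  refine (congrArg₂ (· - ·) hkl rfl).trans ?_
  refine (key _ _ _ _ _ _).trans ?_
  have hsq : √(a ^ 2 * b ^ 2) = a * b := by
    rw [← mul_pow, Real.sqrt_sq (by positivity)]
  have hw : (-(a ^ 2 * b ^ 2) + 1 / 2 * √(a ^ 2 * b ^ 2) * (a ^ 2 + b ^ 2)) / (a ^ 2 - b ^ 2) ^ 2
      = (1 - (d / c) ^ 2) / 8 := by
    have h1 : a - b ≠ 0 := by linarith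
    have h2 : a + b ≠ 0 := by positivity
    have h3 : a ^ 2 - b ^ 2 = (a - b) * (a + b) := by ring
    rw [hsq, h3, hc, hd]
    field_simp
    ring
  rw [hw, smul_eq_mul]
  ring
end
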